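/- Let Σ ∈ ℝ^{n×n} be symmetric positive definite, μ a compactly supported probability measure on ℝ^n, and p_H(x) = ∫ φ_Σ(x − y) dμ(y). Then for every ε > 0 there exists T > 0 such that every bijection φ : ℝ^n → ℝ^n which is a flow map of v from time 0 to time T and transports p_H to p_T satisfies KL(p_H·λ ‖ (φ^{-1})_# γ_n) < ε. -/

import Mathlib

open MeasureTheory Real Filter Set
open scoped ENNReal Topology RealInnerProductSpace Classical

noncomputable section

/-- Gaussian density kernel with covariance `s2 • I`. -/
def gaussKernel (n : ℕ) (s2 : ℝ) (z : EuclideanSpace ℝ (Fin n)) : ℝ :=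
  (2 * π * s2) ^ (-(n : ℝ) / 2) * Real.exp (-‖z‖ ^ 2 / (2 * s2))

/-- VP diffusion marginal `p_t`, with `p_0 = p_H`. -/
def vpMarginal (n : ℕ) (pH : EuclideanSpace ℝ (Fin n) → ℝ) (t : ℝ)
    (x : EuclideanSpace ℝ (Fin n)) : ℝ :=
  if t = 0 then pH x
  else ∫ y, pH y * gaussKernel n (1 - Real.exp (-t)) (x - Real.exp (-t / 2) • y)

/-- The measure with Lebesgue density `p`. -/
def densMeasure (n : ℕ) (p : EuclideanSpace ℝ (Fin n) → ℝ) :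
    Measure (EuclideanSpace ℝ (Fin n)) :=
  volume.withDensity fun x => ENNReal.ofReal (p x)

/-- The standard Gaussian measure `γ_n`. -/
def stdGaussian (n : ℕ) : Measure (EuclideanSpace ℝ (Fin n)) :=
  densMeasure n (gaussKernel n 1)

/-- Score function `s_t = ∇ log p_t`. -/
def score (n : ℕ) (pH : EuclideanSpace ℝ (Fin n) → ℝ) (t : ℝ)
    (x : EuclideanSpace ℝ (Fin n)) : EuclideanSpace ℝ (Fin n) :=
  gradient (fun z => Real.log (vpMarginal n pH t z)) x

/-- Probability-flow vector field `v_t(x) = -x/2 - s_t(x)/2`. -/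
def vField (n : ℕ) (pH : EuclideanSpace ℝ (Fin n) → ℝ) (t : ℝ)
    (x : EuclideanSpace ℝ (Fin n)) : EuclideanSpace ℝ (Fin n) :=
  -(2 : ℝ)⁻¹ • x - (2 : ℝ)⁻¹ • score n pH t x

/-- `φ` is a flow map of `v` from time `s` to time `T`. -/
def IsFlowMap (n : ℕ)
    (v : ℝ → EuclideanSpace ℝ (Fin n) → EuclideanSpace ℝ (Fin n)) (s T : ℝ)
    (φ : EuclideanSpace ℝ (Fin n) → EuclideanSpace ℝ (Fin n)) : Prop :=
  ∀ x, ∃ γ : ℝ → EuclideanSpace ℝ (Fin n),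
    γ s = x ∧ (∀ t ∈ Set.Icc s T, HasDerivAt γ (v t (γ t)) t) ∧ γ T = φ x

/-- Total variation norm `‖μ - ν‖_TV` of the difference of two finite measures. -/
def tvDist {α : Type*} [MeasurableSpace α] (μ ν : Measure α) : ℝ≥0∞ :=
  (⨆ (s : Set α) (_ : MeasurableSet s), μ s - ν s) +
    (⨆ (s : Set α) (_ : MeasurableSet s), ν s - μ s)

/-- Kullback–Leibler divergence. -/
def klDiv {α : Type*} [MeasurableSpace α] (μ ν : Measure α) : ℝ≥0∞ :=
  if μ ≪ ν ∧ Integrable (llr μ ν) μ then ENNReal.ofReal (∫ x, llr μ ν x ∂μ) else ⊤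

/-- A real function is twice differentiable. -/
def TwiceDiff {E : Type*} [NormedAddCommGroup E] [NormedSpace ℝ E] (f : E → ℝ) : Prop :=
  Differentiable ℝ f ∧ Differentiable ℝ (fderiv ℝ f)

/-- Hessian of a real function as a continuous bilinear map. -/
def hessian {E : Type*} [NormedAddCommGroup E] [NormedSpace ℝ E] (f : E → ℝ) (x : E) :
    E →L[ℝ] E →L[ℝ] ℝ :=
  fderiv ℝ (fderiv ℝ f) x

/-- A map is bi-Lipschitz. -/
def BiLipschitz {E : Type*} [NormedAddCommGroup E] (φ : E → E) : Prop :=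
  ∃ c C : ℝ, 0 < c ∧ c ≤ C ∧
    ∀ x y, c * ‖x - y‖ ≤ ‖φ x - φ y‖ ∧ ‖φ x - φ y‖ ≤ C * ‖x - y‖

/-- Centered Gaussian density with covariance matrix `S`. -/
def gaussMat (n : ℕ) (S : Matrix (Fin n) (Fin n) ℝ) (z : EuclideanSpace ℝ (Fin n)) : ℝ :=
  ((2 * π) ^ n * S.det) ^ (-(1 : ℝ) / 2) *
    Real.exp (-(∑ i, z i * S⁻¹.mulVec (fun j => z j) i) / 2)

end

abbrev EE (n : ℕ) := EuclideanSpace ℝ (Fin n)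

lemma aux_gK_meas (n : ℕ) (s : ℝ) : Continuous (gaussKernel n s) := by
  unfold gaussKernel; fun_prop

lemma aux_gK_pos (n : ℕ) (s : ℝ) (hs : 0 < s) (z) : 0 < gaussKernel n s z := by
  unfold gaussKernel; positivity

lemma aux_int_exp (n : ℕ) (b : ℝ) (hb : 0 < b) :
    Integrable (fun v : EE n => Real.exp (-b * ‖v‖ ^ 2)) := by
  by_contra h
  have h1 := GaussianFourier.integral_rexp_neg_mul_sq_norm (V := EE n) hb
  rw [integral_undef h] at h1
  have : 0 < (π / b) ^ (Module.finrank ℝ (EE n) / 2 : ℝ) := by positivity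
  linarith

lemma aux_g1 (n : ℕ) (z : EE n) :
    gaussKernel n 1 z = (2 * π) ^ (-(n : ℝ) / 2) * Real.exp (-(1/2 : ℝ) * ‖z‖ ^ 2) := by
  unfold gaussKernel
  congr 2
  · ring
  · ring

lemma aux_gamma_prob (n : ℕ) : IsProbabilityMeasure (stdGaussian n) := by
  constructor
  unfold stdGaussian densMeasure
  rw [withDensity_apply _ MeasurableSet.univ, Measure.restrict_univ,
    ← ofReal_integral_eq_lintegral_ofReal]
  · simp_rw [aux_g1]
    rw [integral_const_mul, GaussianFourier.integral_rexp_neg_mul_sq_norm (by norm_num)]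
    simp only [finrank_euclideanSpace, Fintype.card_fin]
    have : π / (1 / 2) = 2 * π := by ring
    rw [this, ← Real.rpow_add (by positivity)]
    have : -(n:ℝ)/2 + n / 2 = 0 := by ring
    rw [this]; simp
  · rw [show gaussKernel n 1 = _ from funext (aux_g1 n)]
    exact (aux_int_exp n _ (by norm_num)).const_mul _
  · exact Filter.Eventually.of_forall fun z => (aux_gK_pos n 1 one_pos z).le

lemma aux_gamma_sq (n : ℕ) : Integrable (fun z : EE n => ‖z‖ ^ 2) (stdGaussian n) := by
  unfold stdGaussian densMeasure
  rw [integrable_withDensity_iff_integrable_smul' (by have := aux_gK_meas n 1; fun_prop)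
    (by simp)]
  have h := ((aux_int_exp n (1/4) (by norm_num)).const_mul ((2 * π) ^ (-(n : ℝ) / 2) * 4))
  refine h.mono' ?_ (Filter.Eventually.of_forall fun z => ?_)
  · have := (aux_gK_meas n 1).measurable
    exact Measurable.aestronglyMeasurable (by fun_prop)
  · rw [ENNReal.toReal_ofReal (aux_gK_pos n 1 one_pos z).le, aux_g1]
    have h1 : (0:ℝ) < (2 * π) ^ (-(n : ℝ) / 2) := by positivity
    rw [smul_eq_mul, Real.norm_of_nonneg (by positivity)]
    have h2 : ‖z‖^2 ≤ 4 * Real.exp (1/4 * ‖z‖^2) := by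
      have := Real.add_one_le_exp (1/4 * ‖z‖^2); linarith
    have h3 : Real.exp (-(1/2:ℝ) * ‖z‖^2) * Real.exp (1/4 * ‖z‖^2) = Real.exp (-(1/4) * ‖z‖^2) := by
      rw [← Real.exp_add]; congr 1; ring
    calc _ ≤ (2 * π) ^ (-(n : ℝ) / 2) * Real.exp (-(1/2:ℝ) * ‖z‖^2) * (4 * Real.exp (1/4 * ‖z‖^2)) := by gcongr
      _ = _ := by rw [← h3]; ring

lemma aux_cov (n : ℕ) (L : EE n →ₗ[ℝ] EE n) (hL : LinearMap.det L ≠ 0) (g : EE n → ℝ)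
    (hg : Measurable g) (h : ∀ z, g (L z) * |LinearMap.det L| = gaussKernel n 1 z) (c : EE n)
    (f : EE n → ℝ≥0∞) (hf : Measurable f) :
    ∫⁻ x, ENNReal.ofReal (g (x - c)) * f x = ∫⁻ z, f (L z + c) ∂(stdGaussian n) := by
  have hLm : Measurable L := (LinearMap.continuous_of_finiteDimensional L).measurable
  have e1 : ∫⁻ x, ENNReal.ofReal (g (x - c)) * f x = ∫⁻ x, ENNReal.ofReal (g x) * f (x + c) := by
    rw [← lintegral_add_right_eq_self (fun x => ENNReal.ofReal (g (x - c)) * f x) c]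
    simp
  have e2 : (volume : Measure (EE n)) = ENNReal.ofReal |LinearMap.det L| • Measure.map L volume := by
    rw [Measure.map_linearMap_addHaar_eq_smul_addHaar volume hL, smul_smul,
      ← ENNReal.ofReal_mul (abs_nonneg _), ← abs_mul, mul_inv_cancel₀ hL]
    simp
  rw [e1, e2, lintegral_smul_measure, lintegral_map (by fun_prop) hLm]
  unfold stdGaussian densMeasure
  rw [lintegral_withDensity_eq_lintegral_mul _
    (by have := aux_gK_meas n 1; fun_prop) (by fun_prop), smul_eq_mul,
    ← lintegral_const_mul _ (by fun_prop)]
  refine lintegral_congr fun z => ?_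
  simp only [Pi.mul_apply]
  rw [← h z, ENNReal.ofReal_mul' (abs_nonneg _)]
  ring

lemma aux_gK_scale (n : ℕ) (σ : ℝ) (hσ : 0 < σ) (z : EE n) :
    gaussKernel n (σ^2) ((σ • LinearMap.id : EE n →ₗ[ℝ] EE n) z)
      * |LinearMap.det (σ • LinearMap.id : EE n →ₗ[ℝ] EE n)| = gaussKernel n 1 z := by
  unfold gaussKernel
  simp only [LinearMap.smul_apply, LinearMap.id_apply, LinearMap.det_smul, LinearMap.det_id,
    finrank_euclideanSpace, Fintype.card_fin, mul_one, norm_smul, Real.norm_of_nonneg hσ.le]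
  rw [abs_of_pos (by positivity), Real.mul_rpow (by positivity) (by positivity)]
  have h1 : -(σ * ‖z‖)^2 / (2 * σ^2) = -‖z‖^2/2 := by field_simp
  have h2 : (σ^2) ^ (-(n:ℝ)/2) * σ^n = 1 := by
    rw [← Real.rpow_natCast σ n, ← Real.rpow_natCast σ 2, ← Real.rpow_mul hσ.le,
      ← Real.rpow_add hσ]
    have : ((2:ℕ):ℝ) * (-(n:ℝ)/2) + n = 0 := by push_cast; ring
    rw [this, Real.rpow_zero]
  rw [h1]
  linear_combination (2*π)^(-(n:ℝ)/2) * Real.exp (-‖z‖^2/2) * h2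

lemma aux_gM_cont (n : ℕ) (S : Matrix (Fin n) (Fin n) ℝ) : Continuous (gaussMat n S) := by
  unfold gaussMat Matrix.mulVec dotProduct; fun_prop

lemma aux_gM (n : ℕ) (S : Matrix (Fin n) (Fin n) ℝ) (hS : S.PosDef) :
    ∃ L : EE n →ₗ[ℝ] EE n, LinearMap.det L ≠ 0 ∧
      ∀ z, gaussMat n S (L z) * |LinearMap.det L| = gaussKernel n 1 z := by
  obtain ⟨B, hB⟩ : ∃ B : Matrix (Fin n) (Fin n) ℝ, S = B.transpose * B := by
    open scoped MatrixOrder in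
    obtain ⟨y, hy⟩ := CStarAlgebra.nonneg_iff_eq_star_mul_self.mp hS.posSemidef.nonneg
    exact ⟨y, by simpa [Matrix.star_eq_conjTranspose] using hy⟩
  have hdet : S.det = B.det ^ 2 := by rw [hB, Matrix.det_mul, Matrix.det_transpose]; ring
  have hBd : B.det ≠ 0 := by
    intro h; have := hS.det_pos; rw [hdet, h] at this; simp at this
  have hLd : LinearMap.det (Matrix.toEuclideanLin B.transpose) = B.det := by
    rw [Matrix.toEuclideanLin_eq_toLin_orthonormal, LinearMap.det_toLin, Matrix.det_transpose]
  refine ⟨Matrix.toEuclideanLin B.transpose, by rwa [hLd], fun z => ?_⟩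
  rw [hLd]
  have hu : IsUnit B.det := hBd.isUnit
  have hu' : IsUnit B.transpose.det := by rwa [Matrix.det_transpose]
  have hq : (∑ i, (Matrix.toEuclideanLin B.transpose z) i *
      S⁻¹.mulVec (fun j => (Matrix.toEuclideanLin B.transpose z) j) i) = ‖z‖^2 := by
    have : S⁻¹.mulVec (B.transpose.mulVec z.ofLp) = B⁻¹.mulVec z.ofLp := by
      rw [hB, Matrix.mul_inv_rev, Matrix.mulVec_mulVec, Matrix.mul_assoc,
        Matrix.nonsing_inv_mul _ hu', Matrix.mul_one]
    change dotProduct (B.transpose.mulVec z.ofLp) (S⁻¹.mulVec (B.transpose.mulVec z.ofLp)) = _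
    rw [this, Matrix.mulVec_transpose, ← Matrix.dotProduct_mulVec, Matrix.mulVec_mulVec,
      Matrix.mul_nonsing_inv _ hu, Matrix.one_mulVec, EuclideanSpace.norm_sq_eq]
    simp [dotProduct, sq]
  unfold gaussMat
  rw [hq, hdet, aux_g1]
  have h3 : ((2 * π) ^ n * B.det ^ 2) ^ (-(1:ℝ)/2) * |B.det| = (2*π)^(-(n:ℝ)/2) := by
    rw [← sq_abs B.det]
    have hb : 0 < |B.det| := abs_pos.mpr hBd
    rw [Real.mul_rpow (by positivity) (by positivity), mul_assoc,
      ← Real.rpow_natCast (|B.det|) 2, ← Real.rpow_mul hb.le]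
    have h5 : (((2:ℕ):ℝ) * (-(1:ℝ)/2)) = -1 := by norm_num
    rw [h5, Real.rpow_neg_one, inv_mul_cancel₀ hb.ne', mul_one, ← Real.rpow_natCast,
      ← Real.rpow_mul (by positivity)]
    congr 1; ring
  have h4 : -‖z‖^2/2 = -(1/2:ℝ) * ‖z‖^2 := by ring
  rw [h4, ← h3]; ring

lemma aux_bdd (n : ℕ) (L : EE n →ₗ[ℝ] EE n) (hL : LinearMap.det L ≠ 0) (g : EE n → ℝ)
    (h : ∀ z, g (L z) * |LinearMap.det L| = gaussKernel n 1 z) :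
    ∃ C, ∀ x, 0 < g x ∧ ‖g x‖ ≤ C := by
  have hd : 0 < |LinearMap.det L| := abs_pos.mpr hL
  refine ⟨(2 * π) ^ (-(n : ℝ) / 2) / |LinearMap.det L|, fun x => ?_⟩
  obtain ⟨z, rfl⟩ : ∃ z, L z = x := (LinearMap.equivOfDetNeZero L hL).surjective x
  have h0 : 0 < g (L z) := by
    have := aux_gK_pos n 1 one_pos z
    rw [← h z] at this
    exact pos_of_mul_pos_left this hd.le
  refine ⟨h0, ?_⟩
  rw [Real.norm_of_nonneg h0.le, le_div_iff₀ hd, h z, aux_g1]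
  have : Real.exp (-(1/2 : ℝ) * ‖z‖ ^ 2) ≤ 1 := by
    rw [Real.exp_le_one_iff]; have := sq_nonneg ‖z‖; linarith
  have h1 : (0:ℝ) < (2 * π) ^ (-(n : ℝ) / 2) := by positivity
  nlinarith

lemma aux_ofReal (n : ℕ) (L : EE n →ₗ[ℝ] EE n) (hL : LinearMap.det L ≠ 0) (g : EE n → ℝ)
    (hg : Measurable g) (h : ∀ z, g (L z) * |LinearMap.det L| = gaussKernel n 1 z)
    (ρ : Measure (EE n)) [IsProbabilityMeasure ρ] (c : EE n → EE n) (hc : Measurable c) (x : EE n) :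
    ENNReal.ofReal (∫ y, g (x - c y) ∂ρ) = ∫⁻ y, ENNReal.ofReal (g (x - c y)) ∂ρ := by
  obtain ⟨C, hC⟩ := aux_bdd n L hL g h
  have hm : Measurable fun y => g (x - c y) := by fun_prop
  rw [ofReal_integral_eq_lintegral_ofReal]
  · exact Integrable.of_bound hm.aestronglyMeasurable C
      (Filter.Eventually.of_forall fun y => (hC _).2)
  · exact Filter.Eventually.of_forall fun y => (hC _).1.le

lemma aux_mix (n : ℕ) (L : EE n →ₗ[ℝ] EE n) (hL : LinearMap.det L ≠ 0) (g : EE n → ℝ)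
    (hg : Measurable g) (h : ∀ z, g (L z) * |LinearMap.det L| = gaussKernel n 1 z)
    (ρ : Measure (EE n)) [IsProbabilityMeasure ρ] (c : EE n → EE n) (hc : Measurable c)
    (p : EE n → ℝ) (hp : ∀ x, p x = ∫ y, g (x - c y) ∂ρ) :
    densMeasure n p = Measure.map (fun q : EE n × EE n => L q.1 + c q.2) ((stdGaussian n).prod ρ) := by
  have hLm : Measurable L := (LinearMap.continuous_of_finiteDimensional L).measurable
  have := aux_gamma_prob n
  ext s hs
  have hi : Measurable (s.indicator (1 : EE n → ℝ≥0∞)) := measurable_one.indicator hs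
  rw [← lintegral_indicator_one hs, ← lintegral_indicator_one hs, lintegral_map hi (by fun_prop),
    lintegral_prod_symm _ (by fun_prop)]
  unfold densMeasure
  simp_rw [hp, aux_ofReal n L hL g hg h ρ c hc]
  have hm2 : Measurable fun q : EE n × EE n => ENNReal.ofReal (g (q.1 - c q.2)) := by fun_prop
  rw [lintegral_withDensity_eq_lintegral_mul _ hm2.lintegral_prod_right' hi]
  simp only [Pi.mul_apply]
  simp_rw [← aux_cov n L hL g hg h _ _ hi]
  rw [lintegral_lintegral_swap (by fun_prop)]
  refine lintegral_congr fun x => ?_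
  rw [lintegral_mul_const _ (by fun_prop)]

lemma aux_joint (n : ℕ) (L : EE n →ₗ[ℝ] EE n) (hL : LinearMap.det L ≠ 0) (g : EE n → ℝ)
    (hg : Measurable g) (h : ∀ z, g (L z) * |LinearMap.det L| = gaussKernel n 1 z)
    (ρ : Measure (EE n)) [IsProbabilityMeasure ρ] (c : EE n → EE n) (hc : Measurable c) :
    Measure.map (fun q : EE n × EE n => (L q.1 + c q.2, q.2)) ((stdGaussian n).prod ρ) =
    ((stdGaussian n).prod ρ).withDensity
      (fun q => ENNReal.ofReal (g (q.1 - c q.2) / gaussKernel n 1 q.1)) := by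
  have hLm : Measurable L := (LinearMap.continuous_of_finiteDimensional L).measurable
  have hK := (aux_gK_meas n 1).measurable
  have := aux_gamma_prob n
  ext s hs
  have hi : Measurable (s.indicator (1 : EE n × EE n → ℝ≥0∞)) := measurable_one.indicator hs
  rw [← lintegral_indicator_one hs, ← lintegral_indicator_one hs, lintegral_map hi (by fun_prop),
    lintegral_prod_symm _ (by fun_prop),
    lintegral_withDensity_eq_lintegral_mul _ (by fun_prop) hi,
    lintegral_prod_symm _ (by fun_prop)]
  refine lintegral_congr fun y => ?_
  rw [← aux_cov n L hL g hg h (c y) (fun x => s.indicator (1 : EE n × EE n → ℝ≥0∞) (x, y))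
    (by fun_prop)]
  unfold stdGaussian densMeasure
  rw [lintegral_withDensity_eq_lintegral_mul _ (by fun_prop) (by fun_prop)]
  refine lintegral_congr fun x => ?_
  simp only [Pi.mul_apply]
  rw [← mul_assoc, ← ENNReal.ofReal_mul (aux_gK_pos n 1 one_pos x).le,
    mul_div_cancel₀ _ (aux_gK_pos n 1 one_pos x).ne']

lemma aux_log (n : ℕ) (a σ : ℝ) (hσ : 0 < σ) (z y : EE n) :
    Real.log (gaussKernel n (σ^2) ((σ • z + a • y) - a • y) / gaussKernel n 1 (σ • z + a • y))
     = -(n/2 * Real.log (σ^2)) - ‖z‖^2/2 + ‖σ • z + a • y‖^2/2 := by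
  rw [Real.log_div (aux_gK_pos _ _ (by positivity) _).ne' (aux_gK_pos _ _ one_pos _).ne']
  unfold gaussKernel
  rw [Real.log_mul (by positivity) (by positivity), Real.log_mul (by positivity) (by positivity),
    Real.log_exp, Real.log_exp, Real.log_rpow (by positivity), Real.log_rpow (by positivity),
    Real.log_mul (by positivity) (by positivity), add_sub_cancel_right, norm_smul,
    Real.norm_of_nonneg hσ.le]
  have h1 : -(σ * ‖z‖)^2 / (2 * σ^2) = -‖z‖^2/2 := by field_simp
  rw [h1]; ring_nf

open InformationTheory in
lemma aux_KL (n : ℕ) (a σ : ℝ) (hσ : 0 < σ) (hσ1 : σ ≤ 1) (ha : 0 ≤ a)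
    (ρ : Measure (EE n)) [IsProbabilityMeasure ρ] (hρ : Integrable (fun y : EE n => ‖y‖^2) ρ) :
    InformationTheory.klDiv
      (Measure.map (fun q : EE n × EE n => σ • q.1 + a • q.2) ((stdGaussian n).prod ρ))
      (stdGaussian n) ≤ ENNReal.ofReal (-(n/2 * Real.log (σ^2)) +
        (a/2 * ∫ z, ‖z‖^2 ∂(stdGaussian n) + (a^2+a)/2 * ∫ y, ‖y‖^2 ∂ρ)) := by
  have := aux_gamma_prob n
  set γ := stdGaussian n with hγ
  set J := Measure.map (fun q : EE n × EE n => (σ • q.1 + a • q.2, q.2)) (γ.prod ρ) with hJ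
  have hJp : IsProbabilityMeasure J := Measure.isProbabilityMeasure_map (by fun_prop)
  have e1 : Measure.map (fun q : EE n × EE n => σ • q.1 + a • q.2) (γ.prod ρ) = J.map Prod.fst := by
    rw [hJ, Measure.map_map (by fun_prop) (by fun_prop)]; rfl
  have e2 : γ = (γ.prod ρ).map Prod.fst := by simp [Measure.map_fst_prod]
  rw [e1]
  conv_lhs => rw [e2]
  refine (klDiv_map_le _ _ measurable_fst).trans ?_
  set k : EE n × EE n → ℝ := fun q => gaussKernel n (σ^2) (q.1 - a • q.2) / gaussKernel n 1 q.1
    with hk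
  have hK := (aux_gK_meas n 1).measurable
  have hK2 := (aux_gK_meas n (σ^2)).measurable
  have hkm : Measurable k := by fun_prop
  have hkpos : ∀ q, 0 < k q := fun q =>
    div_pos (aux_gK_pos _ _ (by positivity) _) (aux_gK_pos _ _ one_pos _)
  have hJk : J = (γ.prod ρ).withDensity (fun q => ENNReal.ofReal (k q)) := by
    have hdet : LinearMap.det (σ • LinearMap.id : EE n →ₗ[ℝ] EE n) ≠ 0 := by
      simp [LinearMap.det_smul, hσ.ne']
    exact aux_joint n (σ • LinearMap.id) hdet (gaussKernel n (σ^2)) hK2 (aux_gK_scale n σ hσ) ρ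
      (fun y => a • y) (by fun_prop)
  have hac : J ≪ γ.prod ρ := hJk ▸ withDensity_absolutelyContinuous _ _
  have hllr : llr J (γ.prod ρ) =ᵐ[J] fun q => Real.log (k q) := by
    have h1 : J.rnDeriv (γ.prod ρ) =ᵐ[γ.prod ρ] fun q => ENNReal.ofReal (k q) := by
      conv_lhs => rw [hJk]
      exact Measure.rnDeriv_withDensity _ (by fun_prop)
    filter_upwards [hac.ae_le h1] with q hq
    rw [llr, hq, ENNReal.toReal_ofReal (hkpos q).le]
  have hlog : ∀ q : EE n × EE n, Real.log (k (σ • q.1 + a • q.2, q.2)) =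
      -(n/2 * Real.log (σ^2)) - ‖q.1‖^2/2 + ‖σ • q.1 + a • q.2‖^2/2 :=
    fun q => aux_log n a σ hσ q.1 q.2
  have hI1 : Integrable (fun q : EE n × EE n => ‖q.1‖^2) (γ.prod ρ) := (aux_gamma_sq n).comp_fst ρ
  have hI2 : Integrable (fun q : EE n × EE n => ‖q.2‖^2) (γ.prod ρ) := hρ.comp_snd γ
  have hq1 : ∀ q : EE n × EE n, ‖σ • q.1 + a • q.2‖^2 ≤
      ‖q.1‖^2 + a * (‖q.1‖^2 + ‖q.2‖^2) + a^2 * ‖q.2‖^2 := by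
    intro q
    have h1 : ‖σ • q.1 + a • q.2‖ ≤ σ * ‖q.1‖ + a * ‖q.2‖ := by
      refine (norm_add_le _ _).trans ?_
      rw [norm_smul, norm_smul, Real.norm_of_nonneg hσ.le, Real.norm_of_nonneg ha]
    have h1' : ‖σ • q.1 + a • q.2‖ ≤ ‖q.1‖ + a * ‖q.2‖ := by
      nlinarith [norm_nonneg q.1]
    calc _ ≤ (‖q.1‖ + a * ‖q.2‖)^2 := by gcongr
      _ ≤ _ := by nlinarith [mul_nonneg ha (sq_nonneg (‖q.1‖ - ‖q.2‖))]
  have hI : Integrable (fun q : EE n × EE n => -(n/2 * Real.log (σ^2)) - ‖q.1‖^2/2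
      + ‖σ • q.1 + a • q.2‖^2/2) (γ.prod ρ) := by
    refine ((integrable_const _).sub (hI1.div_const 2)).add (Integrable.div_const ?_ 2)
    refine ((hI1.add ((hI1.add hI2).const_mul a)).add (hI2.const_mul (a^2))).mono'
      (Measurable.aestronglyMeasurable (by fun_prop)) (Filter.Eventually.of_forall fun q => ?_)
    rw [Real.norm_of_nonneg (by positivity)]
    exact hq1 q
  have hFm : Measurable (fun q : EE n × EE n => (σ • q.1 + a • q.2, q.2)) := by fun_prop
  have hlm : Measurable (fun q => Real.log (k q)) := by fun_prop
  have hint : Integrable (fun q => Real.log (k q)) J := by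
    rw [hJ, integrable_map_measure hlm.aestronglyMeasurable hFm.aemeasurable]
    exact hI.congr (Filter.Eventually.of_forall fun q => (hlog q).symm)
  rw [klDiv_of_ac_of_integrable hac (hint.congr hllr.symm)]
  simp only [probReal_univ, add_sub_cancel_right]
  refine ENNReal.ofReal_le_ofReal ?_
  rw [integral_congr_ae hllr, hJ, integral_map hFm.aemeasurable hlm.aestronglyMeasurable]
  simp_rw [hlog]
  have e3 : ∫ z, ‖z‖^2 ∂γ = ∫ q : EE n × EE n, ‖q.1‖^2 ∂(γ.prod ρ) := by
    rw [integral_fun_fst (fun z : EE n => ‖z‖^2)]; simp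
  have e4 : ∫ z, ‖z‖^2 ∂ρ = ∫ q : EE n × EE n, ‖q.2‖^2 ∂(γ.prod ρ) := by
    rw [integral_fun_snd (fun z : EE n => ‖z‖^2)]; simp
  rw [e3, e4, ← integral_const_mul, ← integral_const_mul, ← integral_add (hI1.const_mul _)
    (hI2.const_mul _)]
  have e5 : -(n/2 * Real.log (σ^2)) = ∫ q : EE n × EE n, -(n/2 * Real.log (σ^2)) ∂(γ.prod ρ) := by
    simp
  have hI3 : Integrable (fun q : EE n × EE n => a/2 * ‖q.1‖^2 + (a^2+a)/2 * ‖q.2‖^2) (γ.prod ρ) :=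
    (hI1.const_mul (a/2)).add (hI2.const_mul ((a^2+a)/2))
  conv_rhs => rw [e5]
  rw [← integral_add (integrable_const _) hI3]
  refine integral_mono hI ((integrable_const _).add hI3) fun q => ?_
  have := hq1 q
  simp only [Pi.add_apply]
  linarith

lemma aux_inv (n : ℕ) (P Q : Measure (EE n)) [IsProbabilityMeasure P] [IsProbabilityMeasure Q]
    (φ : EE n → EE n) (hφ : Function.Bijective φ) (hm : Measure.map φ P = Q) :
    AEMeasurable φ P ∧ AEMeasurable (Function.invFun φ) Q ∧
      ∃ B : Set (EE n), MeasurableSet B ∧ Q Bᶜ = 0 ∧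
        ∀ γ : Measure (EE n), γ Bᶜ = 0 → AEMeasurable (Function.invFun φ) γ := by
  have hφm : AEMeasurable φ P := by
    by_contra hcon
    rw [Measure.map_of_not_aemeasurable hcon] at hm
    exact IsProbabilityMeasure.ne_zero Q hm.symm
  have hli : ∀ x, Function.invFun φ (φ x) = x := Function.leftInverse_invFun hφ.1
  obtain ⟨A, hAsub, hA, hA0⟩ := exists_measurable_superset_of_null hφm.ae_eq_mk
  have heq : ∀ x ∈ Aᶜ, φ x = hφm.mk φ x := by
    intro x hx
    by_contra hne
    exact hx (hAsub hne)
  have hinj : InjOn (hφm.mk φ) Aᶜ := by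
    intro x hx y hy hxy
    rw [← heq x hx, ← heq y hy] at hxy
    exact hφ.1 hxy
  have himg : ∀ C : Set (EE n), MeasurableSet C → MeasurableSet (φ '' (Aᶜ ∩ C)) := by
    intro C hC
    have : φ '' (Aᶜ ∩ C) = hφm.mk φ '' (Aᶜ ∩ C) := image_congr fun x hx => heq x hx.1
    rw [this]
    exact (hA.compl.inter hC).image_of_measurable_injOn hφm.measurable_mk
      (hinj.mono inter_subset_left)
  have hB : MeasurableSet (φ '' Aᶜ) := by simpa using himg univ MeasurableSet.univ
  have hQB : Q (φ '' Aᶜ)ᶜ = 0 := by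
    rw [← hm, Measure.map_apply_of_aemeasurable hφm hB.compl, preimage_compl,
      preimage_image_eq _ hφ.1, compl_compl, hA0]
  have key : ∀ γ : Measure (EE n), γ (φ '' Aᶜ)ᶜ = 0 → AEMeasurable (Function.invFun φ) γ := by
    intro γ hγ
    have hr : γ.restrict (φ '' Aᶜ) = γ := Measure.restrict_eq_self_of_ae_mem hγ
    rw [← hr]
    refine aemeasurable_restrict_of_measurable_subtype hB fun C hC => ?_
    have : (fun x : φ '' Aᶜ => Function.invFun φ x) ⁻¹' C = Subtype.val ⁻¹' (φ '' (Aᶜ ∩ C)) := by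
      ext ⟨b, x, hx, rfl⟩
      simp only [mem_preimage, hli, mem_image]
      constructor
      · intro h; exact ⟨x, ⟨hx, h⟩, rfl⟩
      · rintro ⟨x', hx', he⟩
        rw [← hφ.1 he]; exact hx'.2
    rw [this]
    exact measurable_subtype_coe (himg C hC)
  exact ⟨hφm, key Q hQB, _, hB, hQB, key⟩

lemma aux_push (n : ℕ) (P Q γ : Measure (EE n)) [IsProbabilityMeasure P] [IsProbabilityMeasure Q]
    [IsProbabilityMeasure γ] (hγQ : γ ≪ Q)
    (φ : EE n → EE n) (hφ : Function.Bijective φ) (hm : Measure.map φ P = Q)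
    (hQγ : Q ≪ γ) :
    klDiv P (Measure.map (Function.invFun φ) γ) ≤ InformationTheory.klDiv Q γ := by
  obtain ⟨hφm, hψQ, B, hB, hQB, key⟩ := aux_inv n P Q φ hφ hm
  have hψ : AEMeasurable (Function.invFun φ) γ := key γ (hγQ hQB)
  have hP : P = Measure.map (Function.invFun φ) Q := by
    subst hm
    rw [AEMeasurable.map_map_of_aemeasurable hψQ hφm, Function.invFun_comp hφ.1, Measure.map_id]
  have e1 : Measure.map (Function.invFun φ) γ = Measure.map (hψ.mk _) γ :=
    Measure.map_congr hψ.ae_eq_mk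
  have e2 : Measure.map (Function.invFun φ) Q = Measure.map (hψ.mk _) Q :=
    Measure.map_congr (hQγ.ae_le hψ.ae_eq_mk)
  have hp : IsProbabilityMeasure (Measure.map (Function.invFun φ) γ) :=
    Measure.isProbabilityMeasure_map hψ
  have e3 : klDiv P (Measure.map (Function.invFun φ) γ) =
      InformationTheory.klDiv P (Measure.map (Function.invFun φ) γ) := by
    unfold klDiv
    split_ifs with hc
    · rw [InformationTheory.klDiv_of_ac_of_integrable hc.1 hc.2]
      simp
    · symm
      rw [InformationTheory.klDiv_eq_top_iff]
      exact fun h1 h2 => hc ⟨h1, h2⟩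
  rw [e3, hP, e1, e2]
  exact InformationTheory.klDiv_map_le _ _ hψ.measurable_mk

lemma aux_lim (n : ℕ) (M1 M2 : ℝ) : Tendsto (fun t : ℝ =>
    ENNReal.ofReal (-(n/2 * Real.log (1 - Real.exp (-t))) +
        (Real.exp (-t/2)/2 * M1 + ((Real.exp (-t/2))^2+Real.exp (-t/2))/2 * M2))) atTop (𝓝 0) := by
  have h1 : Tendsto (fun t : ℝ => Real.exp (-t)) atTop (𝓝 0) :=
    Real.tendsto_exp_neg_atTop_nhds_zero
  have h2 : Tendsto (fun t : ℝ => Real.exp (-t/2)) atTop (𝓝 0) := by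
    have := h1.comp (tendsto_id.atTop_div_const (show (0:ℝ) < 2 by norm_num))
    refine this.congr fun t => ?_
    simp only [Function.comp, id]; congr 1; ring
  have h3 : Tendsto (fun t : ℝ => Real.log (1 - Real.exp (-t))) atTop (𝓝 0) := by
    have := (h1.const_sub 1).log (by norm_num)
    simpa using this
  have h4 := ((h3.const_mul ((n:ℝ)/2)).neg).add (((h2.div_const 2).mul_const M1).add
    ((((h2.pow 2).add h2).div_const 2).mul_const M2))
  have h5 := ENNReal.tendsto_ofReal h4
  simpa using h5

theorem stmt_10 (n : ℕ) (S : Matrix (Fin n) (Fin n) ℝ) (hS : S.PosDef)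
    (μ : Measure (EuclideanSpace ℝ (Fin n))) [IsProbabilityMeasure μ]
    (hsupp : ∃ Kc : Set (EuclideanSpace ℝ (Fin n)), IsCompact Kc ∧ μ Kcᶜ = 0)
    (pH : EuclideanSpace ℝ (Fin n) → ℝ)
    (hpH : ∀ x, pH x = ∫ y, gaussMat n S (x - y) ∂μ) :
    ∀ ε : ℝ≥0∞, 0 < ε → ∃ T > (0 : ℝ),
      ∀ φ : EuclideanSpace ℝ (Fin n) → EuclideanSpace ℝ (Fin n),
        Function.Bijective φ →
        IsFlowMap n (vField n pH) 0 T φ →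
        Measure.map φ (densMeasure n pH) = densMeasure n (vpMarginal n pH T) →
        klDiv (densMeasure n pH)
          (Measure.map (Function.invFun φ) (stdGaussian n)) < ε := by
  intro ε hε
  have := aux_gamma_prob n
  have hMm := (aux_gM_cont n S).measurable
  obtain ⟨L, hL, hLg⟩ := aux_gM n S hS
  have hLm : Measurable L := (LinearMap.continuous_of_finiteDimensional L).measurable
  have hPeq := aux_mix n L hL (gaussMat n S) hMm hLg μ (fun y => y) measurable_id pH hpH
  set P := densMeasure n pH with hPdef
  have hPp : IsProbabilityMeasure P := by
    rw [hPeq]; exact Measure.isProbabilityMeasure_map (by fun_prop)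
  have hμ2 : Integrable (fun y : EE n => ‖y‖^2) μ := by
    obtain ⟨K, hK, hK0⟩ := hsupp
    obtain ⟨R, hR⟩ := hK.isBounded.exists_norm_le
    refine Integrable.of_bound (Measurable.aestronglyMeasurable (by fun_prop)) (R^2) ?_
    have : ∀ᵐ y ∂μ, y ∈ K := hK0
    filter_upwards [this] with y hy
    rw [Real.norm_of_nonneg (by positivity)]
    have := hR y hy
    gcongr
  have hP2 : Integrable (fun y : EE n => ‖y‖^2) P := by
    rw [hPeq, integrable_map_measure (Measurable.aestronglyMeasurable (by fun_prop))
      (by fun_prop)]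
    let L' : EE n →L[ℝ] EE n := LinearMap.toContinuousLinearMap L
    have hI := (((aux_gamma_sq n).comp_fst μ).const_mul (2 * ‖L'‖^2)).add
      ((hμ2.comp_snd (stdGaussian n)).const_mul 2)
    refine hI.mono' (Measurable.aestronglyMeasurable (by fun_prop))
      (Filter.Eventually.of_forall fun q => ?_)
    simp only [Function.comp, Pi.add_apply]
    rw [Real.norm_of_nonneg (by positivity)]
    have h1 : ‖L q.1‖ ≤ ‖L'‖ * ‖q.1‖ := L'.le_opNorm q.1
    have h2 := norm_add_le (L q.1) q.2
    calc _ ≤ (‖L'‖ * ‖q.1‖ + ‖q.2‖)^2 := by gcongr; linarith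
      _ ≤ _ := by nlinarith [sq_nonneg (‖L'‖ * ‖q.1‖ - ‖q.2‖)]
  have hlim := aux_lim n (∫ z, ‖z‖^2 ∂(stdGaussian n)) (∫ y, ‖y‖^2 ∂P)
  obtain ⟨T, hTε, hT⟩ := ((hlim.eventually_lt_const hε).and (eventually_gt_atTop 0)).exists
  refine ⟨T, hT, fun φ hφ _ hmap => ?_⟩
  have he : Real.exp (-T) < 1 := by rw [Real.exp_lt_one_iff]; linarith
  set a := Real.exp (-T/2) with ha
  set σ := Real.sqrt (1 - Real.exp (-T)) with hσdef
  have hσ : 0 < σ := Real.sqrt_pos.mpr (by linarith)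
  have hσ2 : σ^2 = 1 - Real.exp (-T) := Real.sq_sqrt (by linarith)
  have hσ1 : σ ≤ 1 := by
    have := Real.exp_pos (-T); nlinarith
  have hKm := (aux_gK_meas n (σ^2)).measurable
  have hpHm : Measurable pH := by
    have : StronglyMeasurable fun q : EE n × EE n => gaussMat n S (q.1 - q.2) :=
      Measurable.stronglyMeasurable (by fun_prop)
    have h2 := this.integral_prod_right' (ν := μ)
    rw [show pH = _ from funext hpH]
    exact h2.measurable
  have hpHnn : ∀ x, 0 ≤ pH x := by
    intro x; rw [hpH]
    obtain ⟨C, hC⟩ := aux_bdd n L hL _ hLg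
    exact integral_nonneg fun y => (hC _).1.le
  have hvp : ∀ x, vpMarginal n pH T x = ∫ y, gaussKernel n (σ^2) (x - a • y) ∂P := by
    intro x
    rw [vpMarginal, if_neg hT.ne', hPdef, densMeasure,
      integral_withDensity_eq_integral_toReal_smul (by fun_prop) (by simp), hσ2]
    refine integral_congr_ae (Filter.Eventually.of_forall fun y => ?_)
    simp only [smul_eq_mul]
    rw [ENNReal.toReal_ofReal (hpHnn y)]
  have hdet : LinearMap.det (σ • LinearMap.id : EE n →ₗ[ℝ] EE n) ≠ 0 := by
    simp [LinearMap.det_smul, hσ.ne']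
  have hQeq := aux_mix n (σ • LinearMap.id) hdet (gaussKernel n (σ^2)) hKm (aux_gK_scale n σ hσ) P
    (fun y => a • y) (by fun_prop) (vpMarginal n pH T) hvp
  have hvac : (volume : Measure (EE n)) ≪ densMeasure n (vpMarginal n pH T) := by
    unfold densMeasure
    have hfe : (fun x => ENNReal.ofReal (vpMarginal n pH T x)) =
        fun x => ∫⁻ y, ENNReal.ofReal (gaussKernel n (σ^2) (x - a • y)) ∂P := by
      funext x
      rw [hvp, aux_ofReal n (σ • LinearMap.id) hdet (gaussKernel n (σ^2)) hKm (aux_gK_scale n σ hσ)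
        P (fun y => a • y) (by fun_prop)]
    have hm2 : Measurable fun q : EE n × EE n =>
      ENNReal.ofReal (gaussKernel n (σ^2) (q.1 - a • q.2)) := by fun_prop
    rw [hfe]
    refine withDensity_absolutelyContinuous' hm2.lintegral_prod_right'.aemeasurable
      (Filter.Eventually.of_forall fun x => ?_)
    intro h0
    rw [lintegral_eq_zero_iff (by fun_prop)] at h0
    obtain ⟨y, hy⟩ := h0.exists
    have := aux_gK_pos n (σ^2) (by positivity) (x - a • y)
    simp only [Pi.zero_apply, ENNReal.ofReal_eq_zero] at hy
    linarith
  have hγv : (volume : Measure (EE n)) ≪ stdGaussian n := by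
    unfold stdGaussian densMeasure
    have := (aux_gK_meas n 1).measurable
    refine withDensity_absolutelyContinuous' (by fun_prop)
      (Filter.Eventually.of_forall fun x => ?_)
    have := aux_gK_pos n 1 one_pos x
    simpa using this
  have hγac : stdGaussian n ≪ densMeasure n (vpMarginal n pH T) :=
    (withDensity_absolutelyContinuous _ _ : stdGaussian n ≪ volume).trans hvac
  have hQac : densMeasure n (vpMarginal n pH T) ≪ stdGaussian n :=
    (withDensity_absolutelyContinuous _ _ : _ ≪ volume).trans hγv
  have hQp : IsProbabilityMeasure (densMeasure n (vpMarginal n pH T)) := by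
    rw [hQeq]
    exact Measure.isProbabilityMeasure_map
      (show Measurable fun q : EE n × EE n => σ • q.1 + a • q.2 by fun_prop).aemeasurable
  refine (aux_push n P _ (stdGaussian n) hγac φ hφ hmap hQac).trans_lt ?_
  rw [hQeq]
  refine (aux_KL n a σ hσ hσ1 (Real.exp_pos _).le P hP2).trans_lt ?_
  rw [hσ2]
  exact hTε
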